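/- Let d ≥ 1, c > 0, and let x⃗ : ℝ → ℝ^d be a smooth curve with |x⃗'(t)| < c for all t. Define the relativistic jerk j = b + (η(b, v)/c²) v, where v = D x (x(t) = (c t, x⃗(t))), a = D v, b = D a. Then for every t, j(t) = ((γ⁵/c)(v⃗·B⃗), γ³ M̂ B⃗), where B⃗ = b⃗ + 3 γ² ((v⃗·a⃗)/c²) a⃗. -/

import Mathlib

open scoped RealInnerProductSpace

/-- The Minkowski inner product on `ℝ × ℝ^d`: `η((s,u),(r,w)) = −s r + u·w`. -/
noncomputable def minkowski {d : ℕ} (Z W : ℝ × EuclideanSpace ℝ (Fin d)) : ℝ :=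
  -(Z.1 * W.1) + ⟪Z.2, W.2⟫

section LorentzFactor

variable {E : Type*} [NormedAddCommGroup E] [InnerProductSpace ℝ E]

theorem one_sub_sq_div_sq_pos {x c : ℝ} (hx : 0 ≤ x) (hxc : x < c) : 0 < 1 - x ^ 2 / c ^ 2 := by
  have hc : 0 < c := hx.trans_lt hxc
  rw [sub_pos, div_lt_one (by positivity)]
  gcongr

theorem lorentzFactor_sq_mul {x c : ℝ} (hx : 0 ≤ x) (hxc : x < c) :
    ((1 - x ^ 2 / c ^ 2) ^ (-(1 / 2) : ℝ)) ^ 2 * (c ^ 2 - x ^ 2) = c ^ 2 := by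
  have hc : 0 < c := hx.trans_lt hxc
  have hu := one_sub_sq_div_sq_pos hx hxc
  have h : c ^ 2 - x ^ 2 = c ^ 2 * (1 - x ^ 2 / c ^ 2) := by field_simp
  rw [← Real.rpow_mul_natCast hu.le, h]
  norm_num
  rw [Real.rpow_neg_one, mul_left_comm, inv_mul_cancel₀ hu.ne', mul_one]

theorem hasDerivAt_lorentzFactor {v : ℝ → E} {a : E} {c t : ℝ} (hv : HasDerivAt v a t)
    (hvc : ‖v t‖ < c) :
    HasDerivAt (fun s => (1 - ‖v s‖ ^ 2 / c ^ 2) ^ (-(1 / 2) : ℝ))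
      (((1 - ‖v t‖ ^ 2 / c ^ 2) ^ (-(1 / 2) : ℝ)) ^ 3 * (⟪v t, a⟫ / c ^ 2)) t := by
  have hu := one_sub_sq_div_sq_pos (norm_nonneg (v t)) hvc
  have h := ((hv.norm_sq.div_const (c ^ 2)).const_sub 1).rpow_const
    (p := (-(1 / 2) : ℝ)) (Or.inl hu.ne')
  convert h using 1
  rw [← Real.rpow_mul_natCast hu.le]
  norm_num
  ring

/-- The derivative of `γ • (c, v)`, where `γ' = γ³ p`. -/
theorem hasDerivAt_fourVelocity {γ : ℝ → ℝ} {v : ℝ → E} {a : E} {c p t : ℝ}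
    (hγ : HasDerivAt γ (γ t ^ 3 * p) t) (hv : HasDerivAt v a t) :
    HasDerivAt (fun s => γ s • (c, v s)) (γ t ^ 3 * p * c, (γ t ^ 3 * p) • v t + γ t • a) t := by
  refine (hγ.fun_smul ((hasDerivAt_const t c).prodMk hv)).congr_deriv ?_
  ext
  · simp
  · simp [add_comm]

/-- The derivative of `(γ⁴ p c, γ⁴ p v + γ² a)`, where `γ' = γ³ p`. -/
theorem hasDerivAt_fourAcceleration {γ p : ℝ → ℝ} {v a : ℝ → E} {b : E} {c p' t : ℝ}
    (hγ : HasDerivAt γ (γ t ^ 3 * p t) t) (hp : HasDerivAt p p' t)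
    (hv : HasDerivAt v (a t) t) (ha : HasDerivAt a b t) :
    HasDerivAt (fun s => (γ s ^ 4 * p s * c, (γ s ^ 4 * p s) • v s + γ s ^ 2 • a s))
      ((4 * γ t ^ 6 * p t ^ 2 + γ t ^ 4 * p') * c,
        (4 * γ t ^ 6 * p t ^ 2 + γ t ^ 4 * p') • v t + (3 * γ t ^ 4 * p t) • a t
          + γ t ^ 2 • b) t := by
  have hk : HasDerivAt (fun s => γ s ^ 4 * p s) (4 * γ t ^ 6 * p t ^ 2 + γ t ^ 4 * p') t := by
    refine ((hγ.fun_pow 4).fun_mul hp).congr_deriv ?_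
    push_cast
    ring
  have hg : HasDerivAt (fun s => γ s ^ 2) (2 * γ t ^ 4 * p t) t := by
    refine (hγ.fun_pow 2).congr_deriv ?_
    push_cast
    ring
  refine ((hk.mul_const c).prodMk ((hk.fun_smul hv).fun_add (hg.fun_smul ha))).congr_deriv ?_
  congr 1
  module

end LorentzFactor

/-- Components of the relativistic jerk `j = b + (η(b,v)/c²) v` in the lab frame:
`j = ((γ⁵/c)(v⃗·B⃗), γ³ M̂ B⃗)` with `B⃗ = b⃗ + 3γ²((v⃗·a⃗)/c²) a⃗`. -/
theorem relativistic_jerk_components (d : ℕ) (hd : 1 ≤ d) (c : ℝ) (hc : 0 < c)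
    (xv : ℝ → EuclideanSpace ℝ (Fin d)) (hx : ContDiff ℝ (⊤ : ℕ∞) xv)
    (vv : ℝ → EuclideanSpace ℝ (Fin d)) (hvv : vv = deriv xv)
    (av : ℝ → EuclideanSpace ℝ (Fin d)) (hav : av = deriv vv)
    (bv : ℝ → EuclideanSpace ℝ (Fin d)) (hbv : bv = deriv av)
    (hspeed : ∀ t : ℝ, ‖vv t‖ < c)
    (γ : ℝ → ℝ) (hγ : ∀ t, γ t = (1 - ‖vv t‖ ^ 2 / c ^ 2) ^ (-(1 / 2) : ℝ))
    (X : ℝ → ℝ × EuclideanSpace ℝ (Fin d)) (hX : ∀ t, X t = (c * t, xv t))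
    (v4 : ℝ → ℝ × EuclideanSpace ℝ (Fin d)) (hv4 : ∀ t, v4 t = γ t • deriv X t)
    (a4 : ℝ → ℝ × EuclideanSpace ℝ (Fin d)) (ha4 : ∀ t, a4 t = γ t • deriv v4 t)
    (b4 : ℝ → ℝ × EuclideanSpace ℝ (Fin d)) (hb4 : ∀ t, b4 t = γ t • deriv a4 t)
    (j : ℝ → ℝ × EuclideanSpace ℝ (Fin d))
    (hj : ∀ t, j t = b4 t + (minkowski (b4 t) (v4 t) / c ^ 2) • v4 t)
    (B : ℝ → EuclideanSpace ℝ (Fin d))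
    (hB : ∀ t, B t = bv t + (3 * γ t ^ 2 * (⟪vv t, av t⟫ / c ^ 2)) • av t) :
    ∀ t : ℝ,
      j t = ((γ t ^ 5 / c) * ⟪vv t, B t⟫,
        γ t ^ 3 • (B t + ((γ t ^ 2 / c ^ 2) * ⟪vv t, B t⟫) • vv t)) := by
  have hv_smooth : ContDiff ℝ (⊤ : ℕ∞) vv := hvv ▸ (contDiff_infty_iff_deriv.1 hx).2
  have ha_smooth : ContDiff ℝ (⊤ : ℕ∞) av := hav ▸ (contDiff_infty_iff_deriv.1 hv_smooth).2
  have hdx (t : ℝ) : HasDerivAt xv (vv t) t :=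
    hvv ▸ (contDiff_infty_iff_deriv.1 hx).1.differentiableAt.hasDerivAt
  have hdv (t : ℝ) : HasDerivAt vv (av t) t :=
    hav ▸ (contDiff_infty_iff_deriv.1 hv_smooth).1.differentiableAt.hasDerivAt
  have hda (t : ℝ) : HasDerivAt av (bv t) t :=
    hbv ▸ (contDiff_infty_iff_deriv.1 ha_smooth).1.differentiableAt.hasDerivAt
  have hdγ (t : ℝ) : HasDerivAt γ (γ t ^ 3 * (⟪vv t, av t⟫ / c ^ 2)) t := by
    rw [funext hγ]
    exact hasDerivAt_lorentzFactor (hdv t) (hspeed t)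
  have hdp (t : ℝ) : HasDerivAt (fun s => ⟪vv s, av s⟫ / c ^ 2)
      ((⟪vv t, bv t⟫ + ⟪av t, av t⟫) / c ^ 2) t :=
    ((hdv t).inner ℝ (hda t)).div_const _
  have hv4_eq : v4 = fun t => γ t • (c, vv t) := by
    funext t
    have hdX : HasDerivAt X (c, vv t) t := by
      rw [funext hX]
      simpa using ((hasDerivAt_id t).const_mul c).prodMk (hdx t)
    rw [hv4, hdX.deriv]
  have ha4_eq : a4 = fun t => (γ t ^ 4 * (⟪vv t, av t⟫ / c ^ 2) * c,
      (γ t ^ 4 * (⟪vv t, av t⟫ / c ^ 2)) • vv t + γ t ^ 2 • av t) := by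
    funext t
    rw [ha4, hv4_eq, (hasDerivAt_fourVelocity (hdγ t) (hdv t)).deriv, Prod.smul_mk, smul_eq_mul]
    congr 1
    · ring
    · module
  intro t
  have hγ_sq : γ t ^ 2 * (c ^ 2 - ‖vv t‖ ^ 2) = c ^ 2 := by
    rw [hγ]
    exact lorentzFactor_sq_mul (norm_nonneg _) (hspeed t)
  rw [hj, hb4, ha4_eq, (hasDerivAt_fourAcceleration (hdγ t) (hdp t) (hdv t) (hda t)).deriv,
    hv4_eq, hB]
  set K := 4 * γ t ^ 6 * (⟪vv t, av t⟫ / c ^ 2) ^ 2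
    + γ t ^ 4 * ((⟪vv t, bv t⟫ + ⟪av t, av t⟫) / c ^ 2) with hK
  have hη : minkowski (γ t • (K * c, K • vv t + (3 * γ t ^ 4 * (⟪vv t, av t⟫ / c ^ 2)) • av t
      + γ t ^ 2 • bv t)) (γ t • (c, vv t)) / c ^ 2
      = -K + 3 * γ t ^ 6 * (⟪vv t, av t⟫ / c ^ 2) ^ 2 + γ t ^ 4 * (⟪vv t, bv t⟫ / c ^ 2) := by
    simp only [minkowski, Prod.smul_mk, smul_eq_mul, inner_smul_right, inner_add_right,
      real_inner_self_eq_norm_sq, real_inner_comm (vv t)]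
    field_simp
    linear_combination (-K * c ^ 2) * hγ_sq
  rw [hη]
  simp only [Prod.smul_mk, Prod.mk_add_mk, inner_add_right, inner_smul_right, smul_eq_mul]
  congr 1
  · field_simp
    ring
  · match_scalars <;> field_simp; ring
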